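/- Let G_w be the weak closure of some OTG with n ≥ 5 vertices. Then h(G_w) = n if and only if G_w belongs to φ₃, where φ₃ consists of all complete graphs together with all graphs of the form Z_{n−m} ∨ K_m with n even, 0 ≤ m < n/2, and every vertex of Z_{n−m} having degree n/2 in the whole graph, except the two graphs K_2 ∨ (K_{n/2−1} + K_{n/2−1}) and K_{n/2,n/2}. -/

import Mathlib

open Finset SimpleGraph
open scoped Classical

/-- `X` is a Hamiltonian cycle enforcing set (H-force set) of `G`: `X` is nonempty and
every cycle of `G` containing all vertices of `X` is a Hamiltonian cycle. -/
def IsHForceSet {V : Type*} [Fintype V] [DecidableEq V] (G : SimpleGraph V)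
    (X : Finset V) : Prop :=
  X.Nonempty ∧ ∀ (v : V) (c : G.Walk v v), c.IsCycle → (∀ x ∈ X, x ∈ c.support) →
    c.IsHamiltonianCycle

/-- The H-force number of `G`: the smallest cardinality of an H-force set of `G`. -/
noncomputable def hForce {V : Type*} [Fintype V] [DecidableEq V] (G : SimpleGraph V) : ℕ :=
  sInf {k | ∃ X : Finset V, IsHForceSet G X ∧ X.card = k}

/-- `G` satisfies the condition of Ore's theorem: `d(u) + d(v) ≥ n` for every pair of
nonadjacent vertices `u, v`. -/
def IsOTG {V : Type*} [Fintype V] (G : SimpleGraph V) : Prop :=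
  ∀ u v : V, u ≠ v → ¬G.Adj u v → Fintype.card V ≤ G.degree u + G.degree v

/-- One step of the weak-closure process: `H` is obtained from `G` by joining one pair of
nonadjacent vertices whose degree sum is at least `n + 1`. -/
def WeakStep {V : Type*} [Fintype V] (G H : SimpleGraph V) : Prop :=
  ∃ u v : V, u ≠ v ∧ ¬G.Adj u v ∧ Fintype.card V + 1 ≤ G.degree u + G.degree v ∧
    H = G ⊔ SimpleGraph.edge u v

/-- `H` is a weak closure of `G`: it is obtained from `G` by a finite sequence of weak-closure
steps, and no pair of nonadjacent vertices of `H` has degree sum at least `n + 1`. -/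
def IsWeakClosure {V : Type*} [Fintype V] (G H : SimpleGraph V) : Prop :=
  Relation.ReflTransGen WeakStep G H ∧
    ∀ u v : V, u ≠ v → ¬H.Adj u v → H.degree u + H.degree v < Fintype.card V + 1

/-- The join `G ∨ H` of two graphs on disjoint vertex sets: their disjoint union together
with all edges between the two sides. -/
def graphJoin {α β : Type*} (G : SimpleGraph α) (H : SimpleGraph β) : SimpleGraph (α ⊕ β) :=
  (G ⊕g H) ⊔ completeBipartiteGraph α β

/-- `G` has the form `Z_{n-m} ∨ K_m`, where every vertex of `Z_{n-m}` has degree `n / 2` in the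
whole graph: there is a set `S` of `m` vertices each adjacent to all other vertices (the `K_m`
part), and every vertex outside `S` has degree `n / 2`. -/
def IsZJoinK {V : Type*} [Fintype V] [DecidableEq V] (G : SimpleGraph V) (m : ℕ) : Prop :=
  ∃ S : Finset V, S.card = m ∧ (∀ x ∈ S, ∀ y : V, y ≠ x → G.Adj x y) ∧
    ∀ z : V, z ∉ S → 2 * G.degree z = Fintype.card V

/-- `G` belongs to the class `φ₃`: `G` is complete, or `G = Z_{n-m} ∨ K_m` with `n` even,
`0 ≤ m < n / 2` and every vertex of `Z_{n-m}` of degree `n / 2` in the whole graph, except the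
two graphs `K_2 ∨ (K_{n/2-1} + K_{n/2-1})` and `K_{n/2, n/2}`. -/
def InPhiThree {V : Type*} [Fintype V] [DecidableEq V] (G : SimpleGraph V) : Prop :=
  G = ⊤ ∨
    (Even (Fintype.card V) ∧ (∃ m : ℕ, 2 * m < Fintype.card V ∧ IsZJoinK G m) ∧
      ¬Nonempty (G ≃g graphJoin (⊤ : SimpleGraph (Fin 2))
        ((⊤ : SimpleGraph (Fin (Fintype.card V / 2 - 1))) ⊕g
          (⊤ : SimpleGraph (Fin (Fintype.card V / 2 - 1))))) ∧
      ¬Nonempty (G ≃g completeBipartiteGraph (Fin (Fintype.card V / 2))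
        (Fin (Fintype.card V / 2))))

/-- `x 0, …, x p` are the successive vertices of a path of `G`. -/
structure IsVertexPath {V : Type*} (G : SimpleGraph V) (p : ℕ) (x : ℕ → V) : Prop where
  adj : ∀ i < p, G.Adj (x i) (x (i + 1))
  inj : ∀ i ≤ p, ∀ j ≤ p, x i = x j → i = j

/-- `y` runs periodically through the successive vertices of a cycle of `G` of length `m`. -/
structure IsVertexCycle {V : Type*} (G : SimpleGraph V) (m : ℕ) (y : ℕ → V) : Prop where
  adj : ∀ i, G.Adj (y i) (y (i + 1))
  eq_iff : ∀ i j, y i = y j ↔ i ≡ j [MOD m]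

section Sequences

variable {V : Type*} {G : SimpleGraph V} {p m : ℕ} {x y : ℕ → V}

lemma IsVertexPath.reverse (h : IsVertexPath G p x) : IsVertexPath G p (fun j => x (p - j)) where
  adj i hi := by
    have := (h.adj (p - (i + 1)) (by omega)).symm
    rwa [show p - (i + 1) + 1 = p - i by omega] at this
  inj i hi j hj hij := by
    have := h.inj _ (by omega) _ (by omega) hij
    omega

lemma IsVertexPath.rotate (h : IsVertexPath G p x) {i : ℕ} (hi : i < p)
    (ha : G.Adj (x 0) (x (i + 1))) :
    IsVertexPath G p (fun j => if j ≤ i then x (i - j) else x j) where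
  adj j hj := by
    rcases lt_trichotomy j i with hji | rfl | hji
    · have := (h.adj (i - (j + 1)) (by omega)).symm
      rw [show i - (j + 1) + 1 = i - j by omega] at this
      simpa [hji.le, Nat.succ_le_of_lt hji] using this
    · simpa using ha
    · simpa [show ¬ j ≤ i by omega, show ¬ j + 1 ≤ i by omega] using h.adj j hj
  inj a ha b hb hab := by
    have := h.inj (if a ≤ i then i - a else a) (by split_ifs <;> omega)
      (if b ≤ i then i - b else b) (by split_ifs <;> omega)
      (by split_ifs at hab ⊢ <;> exact hab)
    split_ifs at this <;> omega

lemma IsVertexPath.skip (h : IsVertexPath G (p + 1) x) {i : ℕ} (hi : i < p)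
    (ha : G.Adj (x 0) (x (i + 2))) :
    IsVertexPath G p (fun j => if j ≤ i then x (i - j) else x (j + 1)) where
  adj j hj := by
    rcases lt_trichotomy j i with hji | rfl | hji
    · have := (h.adj (i - (j + 1)) (by omega)).symm
      rw [show i - (j + 1) + 1 = i - j by omega] at this
      simpa [hji.le, Nat.succ_le_of_lt hji] using this
    · simpa using ha
    · simpa [show ¬ j ≤ i by omega, show ¬ j + 1 ≤ i by omega] using h.adj (j + 1) (by omega)
  inj a ha b hb hab := by
    have := h.inj (if a ≤ i then i - a else a + 1) (by split_ifs <;> omega)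
      (if b ≤ i then i - b else b + 1) (by split_ifs <;> omega)
      (by split_ifs at hab ⊢ <;> exact hab)
    split_ifs at this <;> omega

lemma IsVertexPath.snoc (h : IsVertexPath G p x) {w : V} (hw : ∀ i ≤ p, x i ≠ w)
    (ha : G.Adj (x p) w) : IsVertexPath G (p + 1) (fun i => if i ≤ p then x i else w) where
  adj i hi := by
    rcases eq_or_lt_of_le (Nat.lt_succ_iff.1 hi) with rfl | hip
    · simpa using ha
    · simpa [hip.le, Nat.succ_le_of_lt hip] using h.adj i hip
  inj a ha b hb hab := by
    split_ifs at hab with h1 h2 h2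
    · exact h.inj _ h1 _ h2 hab
    · exact absurd hab (hw _ h1)
    · exact absurd hab.symm (hw _ h2)
    · omega

lemma IsVertexPath.toCycle (h : IsVertexPath G p x) (ha : G.Adj (x p) (x 0)) :
    IsVertexCycle G (p + 1) (fun i => x (i % (p + 1))) where
  adj i := by
    have hlt := Nat.mod_lt i (Nat.succ_pos p)
    rcases eq_or_lt_of_le (Nat.lt_succ_iff.1 hlt) with hi | hi
    · have : (i + 1) % (p + 1) = 0 := by rw [Nat.add_mod, hi]; simp
      rw [this, hi]; exact ha
    · have : (i + 1) % (p + 1) = i % (p + 1) + 1 := by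
        rw [← Nat.mod_add_mod]; exact Nat.mod_eq_of_lt (Nat.succ_lt_succ hi)
      rw [this]; exact h.adj _ hi
  eq_iff i j := by
    refine ⟨fun hij => h.inj _ (Nat.lt_succ_iff.1 (Nat.mod_lt _ (Nat.succ_pos p))) _
      (Nat.lt_succ_iff.1 (Nat.mod_lt _ (Nat.succ_pos p))) hij, fun hij => ?_⟩
    rw [show i % (p + 1) = j % (p + 1) from hij]

lemma IsVertexCycle.toPath (h : IsVertexCycle G (p + 1) y) : IsVertexPath G p y where
  adj i _ := h.adj i
  inj i hi j hj hij := by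
    have := (h.eq_iff i j).1 hij
    rwa [Nat.ModEq, Nat.mod_eq_of_lt (by omega), Nat.mod_eq_of_lt (by omega)] at this

lemma IsVertexCycle.apply_add (h : IsVertexCycle G m y) (i : ℕ) : y (i + m) = y i :=
  (h.eq_iff _ _).2 (by simp [Nat.ModEq])

lemma IsVertexCycle.apply_mod (h : IsVertexCycle G m y) (i : ℕ) : y (i % m) = y i :=
  (h.eq_iff _ _).2 (by simp [Nat.ModEq])

lemma IsVertexCycle.shift (h : IsVertexCycle G m y) (k : ℕ) :
    IsVertexCycle G m (fun i => y (i + k)) where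
  adj i := by simpa [add_right_comm] using h.adj (i + k)
  eq_iff i j := by
    rw [h.eq_iff]; exact ⟨Nat.ModEq.add_right_cancel' k, Nat.ModEq.add_right k⟩

/-- The cycle can be traversed so that a prescribed vertex comes last. -/
lemma IsVertexCycle.exists_last (h : IsVertexCycle G (p + 1) y) (j : ℕ) :
    ∃ z, IsVertexCycle G (p + 1) z ∧ (∀ i, z i = y (i + (j + 1))) ∧ z p = y j ∧
      ∀ i, ∃ t ≤ p, z t = y i := by
  refine ⟨_, h.shift (j + 1), fun _ => rfl, ?_, fun i => ?_⟩
  · rw [← h.apply_add j]; congr 1; omega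
  · refine ⟨(i + (p + 1) * (j + 1) - (j + 1)) % (p + 1),
      Nat.lt_succ_iff.1 (Nat.mod_lt _ (Nat.succ_pos p)), ?_⟩
    rw [(h.shift (j + 1)).apply_mod, h.eq_iff, Nat.sub_add_cancel (by nlinarith)]
    simp [Nat.ModEq]

lemma IsVertexPath.card_image [DecidableEq V] (h : IsVertexPath G p x) :
    ((Finset.range (p + 1)).image x).card = p + 1 := by
  rw [Finset.card_image_of_injOn, Finset.card_range]
  intro i hi j hj hij
  simp only [Finset.coe_range, Set.mem_Iio] at hi hj
  exact h.inj i (by omega) j (by omega) hij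

lemma IsVertexPath.lt_card [Fintype V] (h : IsVertexPath G p x) : p < Fintype.card V := by
  classical
  have := h.card_image ▸ Finset.card_le_univ ((Finset.range (p + 1)).image x)
  omega

lemma IsVertexPath.exists_eq [Fintype V] (h : IsVertexPath G p x) (hp : Fintype.card V ≤ p + 1)
    (v : V) : ∃ i ≤ p, x i = v := by
  classical
  have : (Finset.range (p + 1)).image x = Finset.univ := by
    rw [← Finset.card_eq_iff_eq_univ]
    exact le_antisymm (Finset.card_le_univ _) (h.card_image.symm ▸ hp)
  have hv := this ▸ Finset.mem_univ v
  obtain ⟨i, hi, rfl⟩ := Finset.mem_image.1 hv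
  exact ⟨i, Nat.lt_succ_iff.1 (Finset.mem_range.1 hi), rfl⟩

lemma IsVertexPath.exists_notMem [Fintype V] (h : IsVertexPath G p x)
    (hp : p + 1 < Fintype.card V) : ∃ v, ∀ i ≤ p, x i ≠ v := by
  classical
  by_contra! hc
  have : (Finset.univ : Finset V) ⊆ (Finset.range (p + 1)).image x := by
    intro v _
    obtain ⟨i, hi, rfl⟩ := hc v
    exact Finset.mem_image_of_mem _ (Finset.mem_range.2 (by omega))
  have := Finset.card_le_card this
  rw [h.card_image, Finset.card_univ] at this
  omega

lemma IsVertexPath.exists_cycle_of_crossing (h : IsVertexPath G p x) {i : ℕ} (hi : i < p)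
    (h0 : G.Adj (x 0) (x (i + 1))) (hp : G.Adj (x i) (x p)) :
    ∃ y, IsVertexCycle G (p + 1) y :=
  ⟨_, (h.rotate hi h0).toCycle (by simpa [hi.not_ge] using hp.symm)⟩

lemma IsVertexCycle.exists_path_of_adj (h : IsVertexCycle G (p + 1) y) {w : V}
    (hw : ∀ i ≤ p, y i ≠ w) {j : ℕ} (ha : G.Adj (y j) w) : ∃ x, IsVertexPath G (p + 1) x := by
  obtain ⟨z, hz, hzy, hzp, -⟩ := h.exists_last j
  refine ⟨_, hz.toPath.snoc (w := w) (fun i _ => ?_) (hzp ▸ ha)⟩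
  rw [hzy, ← h.apply_mod]
  exact hw _ (Nat.lt_succ_iff.1 (Nat.mod_lt _ (Nat.succ_pos p)))

lemma IsVertexPath.exists_eq_of_ne [Fintype V] (h : IsVertexPath G p x)
    (hp : Fintype.card V = p + 2) {v w : V} (hw : ∀ i ≤ p, x i ≠ w) (hv : v ≠ w) :
    ∃ i ≤ p, x i = v := by
  classical
  by_contra! hn
  have hsub : (range (p + 1)).image x ⊆ (Finset.univ.erase w).erase v := by
    intro u hu
    obtain ⟨i, hi, rfl⟩ := Finset.mem_image.1 hu
    have hi : i ≤ p := Nat.lt_succ_iff.1 (Finset.mem_range.1 hi)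
    simp [hw i hi, hn i hi]
  have := Finset.card_le_card hsub
  rw [h.card_image, Finset.card_erase_of_mem (by simp [hv]),
    Finset.card_erase_of_mem (by simp), Finset.card_univ] at this
  omega

lemma IsVertexCycle.exists_eq_of_ne [Fintype V] (h : IsVertexCycle G m y) (hm : m ≠ 0)
    (hV : Fintype.card V = m + 1) {v w : V} (hw : ∀ i, y i ≠ w) (hv : v ≠ w) :
    ∃ i, y i = v := by
  obtain ⟨p, rfl⟩ := Nat.exists_eq_succ_of_ne_zero hm
  obtain ⟨i, -, hi⟩ := h.toPath.exists_eq_of_ne hV (fun i _ => hw i) hv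
  exact ⟨i, hi⟩

end Sequences

section OddOrder

variable {V : Type*} [Fintype V] {G : SimpleGraph V} {p k : ℕ} {x y : ℕ → V}

lemma degree_head_le_card_filter
    (hN : ∀ w, G.Adj (x 0) w → ∃ i ≤ p, x i = w) :
    G.degree (x 0) ≤ #{i ∈ range p | G.Adj (x 0) (x (i + 1))} := by
  rw [← card_neighborFinset_eq_degree]
  refine le_trans (Finset.card_le_card ?_)
    (Finset.card_image_le (f := fun i => x (i + 1)))
  intro w hw
  rw [mem_neighborFinset] at hw
  obtain ⟨i, hi, rfl⟩ := hN w hw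
  rcases i with _ | i
  · exact absurd hw (G.loopless.irrefl _)
  · exact Finset.mem_image.2 ⟨i, by simp [hw]; omega, rfl⟩

lemma degree_last_le_card_filter
    (hN : ∀ w, G.Adj (x p) w → ∃ i ≤ p, x i = w) :
    G.degree (x p) ≤ #{i ∈ range p | G.Adj (x i) (x p)} := by
  rw [← card_neighborFinset_eq_degree]
  refine le_trans (Finset.card_le_card ?_) (Finset.card_image_le (f := x))
  intro w hw
  rw [mem_neighborFinset] at hw
  obtain ⟨i, hi, rfl⟩ := hN w hw
  have : i ≠ p := by rintro rfl; exact G.loopless.irrefl _ hw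
  exact Finset.mem_image.2 ⟨i, by simp [hw.symm]; omega, rfl⟩

lemma IsVertexPath.exists_cycle_of_lt_degree_add (h : IsVertexPath G p x)
    (h0 : ∀ w, G.Adj (x 0) w → ∃ i ≤ p, x i = w) (hp : ∀ w, G.Adj (x p) w → ∃ i ≤ p, x i = w)
    (hd : p < G.degree (x 0) + G.degree (x p)) : ∃ y, IsVertexCycle G (p + 1) y := by
  by_contra hc
  have hdisj : Disjoint {i ∈ range p | G.Adj (x 0) (x (i + 1))}
      {i ∈ range p | G.Adj (x i) (x p)} := by
    rw [Finset.disjoint_filter]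
    exact fun i hi hi0 hip =>
      hc (h.exists_cycle_of_crossing (Finset.mem_range.1 hi) hi0 hip)
  have := Finset.card_union_of_disjoint hdisj
  have hle := Finset.card_le_card (Finset.union_subset
    (Finset.filter_subset (fun i => G.Adj (x 0) (x (i + 1))) (range p))
    (Finset.filter_subset (fun i => G.Adj (x i) (x p)) (range p)))
  rw [Finset.card_range] at hle
  have := degree_head_le_card_filter h0
  have := degree_last_le_card_filter hp
  omega

/-- In a graph of order `2k + 1` and minimum degree at least `k`, each non-spanning cycle has
an edge leaving it. -/
lemma IsVertexCycle.exists_adj_notMem (h : IsVertexCycle G (p + 1) y)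
    (hV : Fintype.card V = 2 * k + 1) (hd : ∀ v, k ≤ G.degree v) (hp : p < 2 * k) :
    ∃ w j, (∀ i ≤ p, y i ≠ w) ∧ G.Adj (y j) w := by
  obtain ⟨w, hw⟩ := h.toPath.exists_notMem (by omega)
  by_contra! hc
  set C := (range (p + 1)).image y with hC
  have hCmem : ∀ v, v ∈ C ↔ ∃ i ≤ p, y i = v := by simp [hC]
  have h0 : insert (y 0) (G.neighborFinset (y 0)) ⊆ C := by
    intro v hv
    rw [hCmem]
    rcases Finset.mem_insert.1 hv with rfl | hv
    · exact ⟨0, Nat.zero_le _, rfl⟩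
    · by_contra! hn
      exact hc v 0 hn (by simpa using hv)
  have h1 : insert w (G.neighborFinset w) ⊆ Cᶜ := by
    intro v hv
    rw [Finset.mem_compl, hCmem]
    rintro ⟨i, hi, rfl⟩
    rcases Finset.mem_insert.1 hv with hv | hv
    · exact hw i hi hv
    · exact hc w i hw (by simpa using (G.mem_neighborFinset _ _).1 hv |>.symm)
  have h0' := Finset.card_le_card h0
  have h1' := Finset.card_le_card h1
  rw [Finset.card_insert_of_notMem (by simp), card_neighborFinset_eq_degree] at h0' h1'
  rw [Finset.card_compl] at h1'
  have := hd (y 0)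
  have := hd w
  omega

lemma exists_isVertexPath (hV : Fintype.card V = 2 * k + 1) (hd : ∀ v, k ≤ G.degree v) :
    ∀ p ≤ 2 * k, ∃ x, IsVertexPath G p x := by
  intro p
  induction p with
  | zero =>
    intro _
    obtain ⟨v⟩ : Nonempty V := Fintype.card_pos_iff.1 (by omega)
    exact ⟨fun _ => v, fun i hi => absurd hi (Nat.not_lt_zero i), fun i hi j hj _ => by omega⟩
  | succ p ih =>
    intro hp
    obtain ⟨x, hx⟩ := ih (by omega)
    by_cases hl : ∀ w, G.Adj (x p) w → ∃ i ≤ p, x i = w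
    · by_cases h0 : ∀ w, G.Adj (x 0) w → ∃ i ≤ p, x i = w
      · obtain ⟨y, hy⟩ := hx.exists_cycle_of_lt_degree_add h0 hl
          (by have := hd (x 0); have := hd (x p); omega)
        obtain ⟨w, j, hw, ha⟩ := hy.exists_adj_notMem hV hd (by omega)
        exact hy.exists_path_of_adj hw ha
      · push Not at h0
        obtain ⟨w, ha, hw⟩ := h0
        exact ⟨_, hx.reverse.snoc (w := w) (fun i _ => hw _ (by omega)) (by simpa using ha)⟩
    · push Not at hl
      obtain ⟨w, ha, hw⟩ := hl
      exact ⟨_, hx.snoc hw ha⟩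

/-- A cycle missing exactly one vertex of a non-Hamiltonian graph of order `2k + 1` and minimum
degree at least `k` yields a large independent set. -/
lemma IsVertexCycle.exists_independent (hk : 1 ≤ k) (h : IsVertexCycle G (2 * k) y)
    (hV : Fintype.card V = 2 * k + 1) (hd : ∀ v, k ≤ G.degree v)
    (hc : ¬ ∃ y, IsVertexCycle G (2 * k + 1) y) :
    ∃ I : Finset V, k + 1 ≤ #I ∧ ∀ a ∈ I, ∀ b ∈ I, ¬ G.Adj a b := by
  obtain ⟨q, hq⟩ : ∃ q, 2 * k = q + 1 := ⟨2 * k - 1, by omega⟩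
  rw [hq] at h hV hc
  obtain ⟨w, hw⟩ := h.toPath.exists_notMem (by omega)
  have hw' : ∀ i, y i ≠ w := fun i => by
    rw [← h.apply_mod]
    exact hw _ (Nat.lt_succ_iff.1 (Nat.mod_lt _ (Nat.succ_pos q)))
  have hon : ∀ v, v ≠ w → ∃ i ≤ q, y i = v := fun v hv => h.toPath.exists_eq_of_ne (by omega) hw hv
  have hsucc : ∀ j, G.Adj (y j) w → ¬ G.Adj w (y (j + 1)) := by
    intro j hj hj'
    obtain ⟨z, hz, hzy, hzp, -⟩ := h.exists_last j
    refine hc ⟨_, (hz.toPath.snoc (w := w) (fun i _ => hzy i ▸ hw' _) (hzp ▸ hj)).toCycle ?_⟩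
    simpa [hzy] using hj'
  have hsucc2 : ∀ i j, G.Adj (y i) w → G.Adj (y j) w → ¬ G.Adj (y (i + 1)) (y (j + 1)) := by
    intro i j hi hj ha
    obtain ⟨z, hz, hzy, hzp, hzt⟩ := h.exists_last i
    obtain ⟨t, ht, htj⟩ := hzt j
    have htj' : z (t + 1) = y (j + 1) := by
      rw [hzy, h.eq_iff]
      rw [hzy, h.eq_iff] at htj
      convert htj.add_right 1 using 1; omega
    have hz0 : z 0 = y (i + 1) := by rw [hzy]; congr 1; omega
    rcases eq_or_lt_of_le ht with rfl | htq
    · have h0 : z (t + 1) = z 0 := by simpa using hz.apply_add 0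
      rw [← hz0, ← htj', h0] at ha
      exact G.loopless.irrefl _ ha
    · rw [← hz0, ← htj'] at ha
      refine hc ⟨_, ((hz.toPath.rotate htq ha).snoc (w := w) (fun i _ => ?_) ?_).toCycle ?_⟩
      · split_ifs <;> exact hzy _ ▸ hw' _
      · simpa [htq.not_ge, hzp] using hi
      · simpa [htj] using hj.symm
  set J := {j ∈ range (q + 1) | G.Adj (y j) w} with hJ
  have hJc : k ≤ #J := by
    refine (hd w).trans ?_
    rw [← card_neighborFinset_eq_degree]
    refine le_trans (Finset.card_le_card ?_) (Finset.card_image_le (f := y))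
    intro v hv
    rw [mem_neighborFinset] at hv
    obtain ⟨i, hi, rfl⟩ := hon v hv.ne'
    exact Finset.mem_image_of_mem _ (by simp [hJ, hv.symm]; omega)
  have hinj : Set.InjOn (fun j => y (j + 1)) J := by
    intro a ha b hb hab
    have ha := Finset.mem_range.1 (Finset.mem_of_mem_filter _ ha)
    have hb := Finset.mem_range.1 (Finset.mem_of_mem_filter _ hb)
    have := Nat.ModEq.add_right_cancel' 1 ((h.eq_iff _ _).1 hab)
    rwa [Nat.ModEq, Nat.mod_eq_of_lt ha, Nat.mod_eq_of_lt hb] at this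
  refine ⟨insert w (J.image fun j => y (j + 1)), ?_, ?_⟩
  · rw [Finset.card_insert_of_notMem, Finset.card_image_of_injOn hinj]
    · omega
    · simp only [Finset.mem_image, not_exists, not_and]
      exact fun j _ => hw' _
  · intro a ha b hb
    rw [Finset.mem_insert, Finset.mem_image] at ha hb
    rcases ha with rfl | ⟨i, hi, rfl⟩ <;> rcases hb with rfl | ⟨j, hj, rfl⟩
    · exact G.loopless.irrefl _
    · exact hsucc j (Finset.mem_filter.1 hj).2
    · exact fun h => hsucc i (Finset.mem_filter.1 hi).2 h.symm
    · exact hsucc2 i j (Finset.mem_filter.1 hi).2 (Finset.mem_filter.1 hj).2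

lemma eq_range_of_downward_closed (F : Finset ℕ) (h : ∀ i, i + 1 ∈ F → i ∈ F) :
    F = range #F := by
  have hle : ∀ d i, i + d ∈ F → i ∈ F := by
    intro d
    induction d with
    | zero => exact fun i hi => hi
    | succ d ih => exact fun i hi => ih i (h _ hi)
  refine Finset.eq_of_subset_of_card_le (fun i hi => ?_) (by simp)
  have : range (i + 1) ⊆ F := fun j hj => by
    have : j < i + 1 := Finset.mem_range.1 hj
    exact hle (i - j) j (by rwa [Nat.add_sub_cancel' (by omega)])
  have := Finset.card_le_card this
  rw [Finset.card_range] at this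
  exact Finset.mem_range.2 this

/-- The ends of a Hamiltonian path in a graph of order `2k + 1` and minimum degree at least `k`
that has no cycle of length `2k` or `2k + 1` see exactly the nearer half of the path. -/
lemma IsVertexPath.adj_head_iff (hk : 1 ≤ k) (h : IsVertexPath G (2 * k) x)
    (hV : Fintype.card V = 2 * k + 1) (hd : ∀ v, k ≤ G.degree v)
    (hc : ¬ ∃ y, IsVertexCycle G (2 * k + 1) y) (hc' : ¬ ∃ y, IsVertexCycle G (2 * k) y)
    {i : ℕ} (hi : i < 2 * k) : G.Adj (x 0) (x (i + 1)) ↔ i < k := by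
  set F := {i ∈ range (2 * k) | G.Adj (x 0) (x (i + 1))} with hF
  set L := {i ∈ range (2 * k) | G.Adj (x i) (x (2 * k))} with hL
  have hdisj : Disjoint F L := by
    rw [Finset.disjoint_filter]
    exact fun i hi hi0 hip =>
      hc (h.exists_cycle_of_crossing (Finset.mem_range.1 hi) hi0 hip)
  have hall := h.exists_eq (by omega)
  have hFk : k ≤ #F := (hd _).trans (degree_head_le_card_filter fun w _ => hall w)
  have hLk : k ≤ #L := (hd _).trans (degree_last_le_card_filter fun w _ => hall w)
  have hsub : F ∪ L ⊆ range (2 * k) :=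
    Finset.union_subset (Finset.filter_subset _ _) (Finset.filter_subset _ _)
  have hcard := Finset.card_union_of_disjoint hdisj
  have hunion : F ∪ L = range (2 * k) :=
    Finset.eq_of_subset_of_card_le hsub (by rw [Finset.card_range]; omega)
  have hle := Finset.card_le_card hsub
  rw [Finset.card_range] at hle
  have hdown : ∀ i, i + 1 ∈ F → i ∈ F := by
    intro i hi
    rw [hF, Finset.mem_filter, Finset.mem_range] at hi
    have hu : i ∈ F ∪ L := hunion ▸ Finset.mem_range.2 (by omega)
    refine (Finset.mem_union.1 hu).resolve_right fun hl => hc' ?_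
    obtain ⟨q, hq⟩ : ∃ q, 2 * k = q + 1 := ⟨2 * k - 1, by omega⟩
    have hl := (Finset.mem_filter.1 hl).2
    rw [hq] at h hi hl ⊢
    refine ⟨_, (h.skip (i := i) (by omega) hi.2).toCycle ?_⟩
    simpa [show ¬ q ≤ i by omega] using hl.symm
  have hFr := eq_range_of_downward_closed F hdown
  rw [show #F = k by omega] at hFr
  rw [← Finset.mem_range, ← hFr, hF]
  simp [hi]

/-- A graph of order `2k + 1` and minimum degree at least `k` is Hamiltonian, or has an
independent set of size `k + 1`, or is separated by the middle vertex of a Hamiltonian path. -/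
theorem hamiltonian_or_independent_or_cut (hk : 1 ≤ k) (hV : Fintype.card V = 2 * k + 1)
    (hd : ∀ v, k ≤ G.degree v) :
    (∃ y, IsVertexCycle G (2 * k + 1) y) ∨
    (∃ I : Finset V, k + 1 ≤ #I ∧ ∀ a ∈ I, ∀ b ∈ I, ¬ G.Adj a b) ∨
    ∃ x, IsVertexPath G (2 * k) x ∧ ∀ a < k, ∀ b, k < b → b ≤ 2 * k → ¬ G.Adj (x a) (x b) := by
  by_cases hc : ∃ y, IsVertexCycle G (2 * k + 1) y
  · exact Or.inl hc
  by_cases hc' : ∃ y, IsVertexCycle G (2 * k) y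
  · obtain ⟨y, hy⟩ := hc'
    exact Or.inr (Or.inl (hy.exists_independent hk hV hd hc))
  obtain ⟨x, hx⟩ := exists_isVertexPath hV hd (2 * k) le_rfl
  refine Or.inr (Or.inr ⟨x, hx, fun a ha b hb hbk hab => ?_⟩)
  have hr := hx.rotate (i := a) (by omega)
    ((hx.adj_head_iff hk hV hd hc hc' (by omega)).2 ha)
  obtain ⟨b, rfl⟩ : ∃ c, b = c + 1 := ⟨b - 1, by omega⟩
  have := (hr.adj_head_iff hk hV hd hc hc' (i := b) (by omega)).1
    (by simpa [show ¬ b + 1 ≤ a by omega] using hab)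
  omega

end OddOrder

section Walks

variable {V : Type*} {G : SimpleGraph V} {m : ℕ} {y : ℕ → V}

lemma exists_walk_of_adj (h : ∀ i, G.Adj (y i) (y (i + 1))) (m : ℕ) :
    ∃ w : G.Walk (y 0) (y m), w.support = (List.range (m + 1)).map y ∧
      w.edges = (List.range m).map fun i => s(y i, y (i + 1)) := by
  induction m with
  | zero => exact ⟨Walk.nil, by simp, by simp⟩
  | succ m ih =>
    obtain ⟨w, hw, hw'⟩ := ih
    refine ⟨w.concat (h m), ?_, ?_⟩
    · rw [Walk.support_concat, hw, List.range_succ (n := m + 1)]; simp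
    · rw [Walk.edges_concat, hw', List.range_succ (n := m)]; simp

lemma IsVertexCycle.exists_isCycle (h : IsVertexCycle G m y) (hm : 3 ≤ m) :
    ∃ (v : V) (c : G.Walk v v), c.IsCycle ∧ ∀ u, u ∈ c.support ↔ ∃ i, y i = u := by
  obtain ⟨p, rfl⟩ : ∃ p, m = p + 1 := ⟨m - 1, by omega⟩
  obtain ⟨w, hw, hw'⟩ := exists_walk_of_adj h.adj p
  have h0 : y (p + 1) = y 0 := by simpa using h.apply_add 0
  have ha : G.Adj (y p) (y 0) := h0 ▸ h.adj p
  have hinj := h.toPath.inj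
  refine ⟨_, Walk.cons ha w, (Walk.cons_isCycle_iff _ _).2 ⟨?_, ?_⟩, ?_⟩
  · rw [Walk.isPath_def, hw]
    refine List.nodup_range.map_on ?_
    intro i hi j hj hij
    rw [List.mem_range] at hi hj
    exact hinj i (by omega) j (by omega) hij
  · rw [hw', List.mem_map]
    rintro ⟨i, hi, hie⟩
    rw [List.mem_range] at hi
    rcases Sym2.eq_iff.1 hie with ⟨h1, -⟩ | ⟨h1, h2⟩
    · have := hinj i (by omega) p le_rfl h1; omega
    · have := hinj i (by omega) 0 (by omega) h1
      have := hinj (i + 1) (by omega) p le_rfl h2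
      omega
  · intro u
    rw [Walk.support_cons, List.mem_cons, hw, List.mem_map]
    constructor
    · rintro (rfl | ⟨i, -, rfl⟩) <;> exact ⟨_, rfl⟩
    · rintro ⟨i, rfl⟩
      exact Or.inr ⟨i % (p + 1), List.mem_range.2 (Nat.mod_lt _ (Nat.succ_pos p)), h.apply_mod i⟩

lemma SimpleGraph.Walk.IsCycle.exists_isVertexCycle {v : V} {c : G.Walk v v} (hc : c.IsCycle) :
    ∃ y, IsVertexCycle G c.length y ∧ ∀ u, u ∈ c.support ↔ ∃ i, y i = u := by
  obtain ⟨p, hp⟩ : ∃ p, c.length = p + 1 := ⟨c.length - 1, by have := hc.three_le_length; omega⟩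
  have hpath : IsVertexPath G p c.getVert :=
    { adj := fun i hi => c.adj_getVert_succ (by omega)
      inj := fun i hi j hj hij => hc.getVert_injOn' (by simp only [Set.mem_ofPred_eq]; omega)
        (by simp only [Set.mem_ofPred_eq]; omega) hij }
  have hlast : c.getVert (p + 1) = c.getVert 0 := by
    rw [← hp, Walk.getVert_length, Walk.getVert_zero]
  have ha : G.Adj (c.getVert p) (c.getVert 0) := hlast ▸ c.adj_getVert_succ (by omega)
  refine ⟨_, hp ▸ hpath.toCycle ha, fun u => ⟨fun hu => ?_, ?_⟩⟩
  · obtain ⟨i, rfl, hi⟩ := Walk.mem_support_iff_exists_getVert.1 hu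
    rcases eq_or_lt_of_le (hp ▸ hi) with rfl | hi
    · exact ⟨0, by simp [hlast]⟩
    · exact ⟨i, congrArg _ (Nat.mod_eq_of_lt (hp ▸ hi))⟩
  · rintro ⟨i, rfl⟩
    exact c.getVert_mem_support _

end Walks

/-- `h(G)` is maximal iff every vertex-deleted subgraph is Hamiltonian. -/
lemma hForce_eq_card_iff {V : Type*} [Fintype V] [DecidableEq V] (G : SimpleGraph V) {m : ℕ}
    (hm : 3 ≤ m) (hV : Fintype.card V = m + 1) :
    hForce G = Fintype.card V ↔ ∀ v, ∃ y, IsVertexCycle G m y ∧ ∀ i, y i ≠ v := by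
  constructor
  · intro h v
    have hv : ¬ IsHForceSet G (Finset.univ.erase v) := by
      intro hX
      have : hForce G ≤ _ := Nat.sInf_le ⟨_, hX, rfl⟩
      rw [Finset.card_erase_of_mem (Finset.mem_univ v), Finset.card_univ] at this
      omega
    have hne : (Finset.univ.erase v).Nonempty := by
      rw [← Finset.card_pos, Finset.card_erase_of_mem (Finset.mem_univ v), Finset.card_univ]
      omega
    simp only [IsHForceSet, hne, true_and, not_forall] at hv
    obtain ⟨u, c, hc, hsup, hnot⟩ := hv
    rw [Walk.isHamiltonianCycle_iff_isCycle_and_length_eq, not_and] at hnot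
    have hlen := hnot hc
    obtain ⟨y, hy, hys⟩ := hc.exists_isVertexCycle
    have h3 := hc.three_le_length
    obtain ⟨p, hp⟩ : ∃ p, c.length = p + 1 := ⟨c.length - 1, by omega⟩
    rw [hp] at hy
    have hlt := hy.toPath.lt_card
    have hvy : ∀ i, y i ≠ v := by
      intro i hi
      obtain ⟨w, hw⟩ := hy.toPath.exists_notMem (by omega)
      have hwv : w ≠ v := by
        rintro rfl
        refine hw (i % (p + 1)) (Nat.lt_succ_iff.1 (Nat.mod_lt _ (Nat.succ_pos p))) ?_
        rw [hy.apply_mod, hi]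
      obtain ⟨j, rfl⟩ := (hys w).1 (hsup w (by simp [hwv]))
      exact hw _ (Nat.lt_succ_iff.1 (Nat.mod_lt _ (Nat.succ_pos p))) (hy.apply_mod j)
    have hsub : Finset.univ.erase v ⊆ (range (p + 1)).image y := by
      intro w hw
      obtain ⟨j, rfl⟩ := (hys w).1 (hsup w (by simpa using hw))
      exact Finset.mem_image.2
        ⟨_, Finset.mem_range.2 (Nat.mod_lt _ (Nat.succ_pos p)), hy.apply_mod j⟩
    have := Finset.card_le_card hsub
    rw [hy.toPath.card_image, Finset.card_erase_of_mem (Finset.mem_univ v),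
      Finset.card_univ] at this
    obtain rfl : m = p + 1 := by omega
    exact ⟨y, hy, hvy⟩
  · intro h
    have huniv : IsHForceSet G Finset.univ := by
      refine ⟨Finset.card_pos.1 (by rw [Finset.card_univ]; omega), fun v c hc hsup => ?_⟩
      rw [Walk.isHamiltonianCycle_iff_isCycle_and_length_eq]
      refine ⟨hc, ?_⟩
      obtain ⟨y, hy, hys⟩ := hc.exists_isVertexCycle
      have h3 := hc.three_le_length
      obtain ⟨p, hp⟩ : ∃ p, c.length = p + 1 := ⟨c.length - 1, by omega⟩
      rw [hp] at hy ⊢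
      have hlt := hy.toPath.lt_card
      by_contra hne
      obtain ⟨w, hw⟩ := hy.toPath.exists_notMem (by omega)
      obtain ⟨j, rfl⟩ := (hys w).1 (hsup w (Finset.mem_univ w))
      exact hw _ (Nat.lt_succ_iff.1 (Nat.mod_lt _ (Nat.succ_pos p))) (hy.apply_mod j)
    have hall : ∀ X, IsHForceSet G X → X = Finset.univ := by
      intro X hX
      by_contra hne
      obtain ⟨v, hv⟩ : ∃ v, v ∉ X := by
        by_contra! hall
        exact hne (Finset.eq_univ_iff_forall.2 hall)
      obtain ⟨y, hy, hyv⟩ := h v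
      obtain ⟨u, c, hc, hcs⟩ := hy.exists_isCycle hm
      have hH := hX.2 u c hc fun w hw => (hcs w).2
        (hy.exists_eq_of_ne (by omega) hV hyv (by rintro rfl; exact hv hw))
      obtain ⟨i, hi⟩ := (hcs v).1 (hH.mem_support v)
      exact hyv i hi
    have hset : {k | ∃ X : Finset V, IsHForceSet G X ∧ X.card = k} = {Fintype.card V} := by
      ext k
      constructor
      · rintro ⟨X, hX, rfl⟩
        rw [hall X hX]; exact Finset.card_univ
      · rintro rfl
        exact ⟨_, huniv, Finset.card_univ⟩
    rw [hForce, hset, csInf_singleton]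

section Obstructions

variable {V : Type*} [Fintype V] {G : SimpleGraph V} {m : ℕ} {y : ℕ → V}

/-- If deleting two vertices separates the graph, then deleting just one of them leaves a
non-Hamiltonian graph. -/
lemma IsVertexCycle.not_separated (h : IsVertexCycle G m y) (hm : m ≠ 0)
    (hV : Fintype.card V = m + 1) {c c' : V} (hc : ∀ i, y i ≠ c) (hcc : c' ≠ c) (P : V → Prop)
    (hP : ∀ a b, a ≠ c → a ≠ c' → b ≠ c → b ≠ c' → G.Adj a b → (P a ↔ P b))
    {a b : V} (hac : a ≠ c) (hac' : a ≠ c') (hbc : b ≠ c) (hbc' : b ≠ c') : P a ↔ P b := by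
  obtain ⟨p, rfl⟩ := Nat.exists_eq_succ_of_ne_zero hm
  obtain ⟨j, hj⟩ := h.exists_eq_of_ne hm hV hc hcc
  obtain ⟨z, hz, hzy, hzp, -⟩ := h.exists_last j
  rw [hj] at hzp
  have hzc : ∀ i, z i ≠ c := fun i => hzy i ▸ hc _
  have hz' : ∀ i < p, z i ≠ c' := by
    intro i hi hic
    have := hz.toPath.inj i hi.le p le_rfl (hic.trans hzp.symm)
    omega
  have hPz : ∀ i < p, (P (z i) ↔ P (z 0)) := by
    intro i
    induction i with
    | zero => exact fun _ => Iff.rfl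
    | succ i ih =>
      intro hi
      rw [← ih (by omega)]
      exact (hP _ _ (hzc _) (hz' _ (by omega)) (hzc _) (hz' _ hi) (hz.adj i)).symm
  have hPa : ∀ u, u ≠ c → u ≠ c' → (P u ↔ P (z 0)) := by
    intro u hu hu'
    obtain ⟨i, hi, rfl⟩ := hz.toPath.exists_eq_of_ne hV (fun i _ => hzc i) hu
    exact hPz i (lt_of_le_of_ne hi (by rintro rfl; exact hu' hzp))
  rw [hPa a hac hac', hPa b hbc hbc']

/-- Deleting a vertex outside an independent set containing half of the vertices leaves a
non-Hamiltonian graph. -/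
lemma IsVertexCycle.card_independent_lt (h : IsVertexCycle G m y) (hm : m ≠ 0)
    (hV : Fintype.card V = m + 1) {c : V} (hc : ∀ i, y i ≠ c) {I : Finset V} (hcI : c ∉ I)
    (hI : ∀ a ∈ I, ∀ b ∈ I, ¬ G.Adj a b) : 2 * #I < Fintype.card V := by
  set J := {j ∈ range m | y j ∈ I} with hJ
  have hIJ : I ⊆ J.image y := by
    intro v hv
    obtain ⟨i, rfl⟩ := h.exists_eq_of_ne hm hV hc (ne_of_mem_of_not_mem hv hcI)
    refine Finset.mem_image.2 ⟨i % m, ?_, h.apply_mod i⟩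
    rw [hJ, Finset.mem_filter, h.apply_mod]
    exact ⟨Finset.mem_range.2 (Nat.mod_lt _ (Nat.pos_of_ne_zero hm)), hv⟩
  have hinj : Set.InjOn (fun j => y (j + 1)) J := by
    intro a ha b hb hab
    have ha := Finset.mem_range.1 (Finset.mem_of_mem_filter _ ha)
    have hb := Finset.mem_range.1 (Finset.mem_of_mem_filter _ hb)
    have := Nat.ModEq.add_right_cancel' 1 ((h.eq_iff _ _).1 hab)
    rwa [Nat.ModEq, Nat.mod_eq_of_lt ha, Nat.mod_eq_of_lt hb] at this
  have hsub : J.image (fun j => y (j + 1)) ⊆ (insert c I)ᶜ := by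
    intro v hv
    obtain ⟨j, hj, rfl⟩ := Finset.mem_image.1 hv
    rw [Finset.mem_compl, Finset.mem_insert, not_or]
    exact ⟨hc _, fun hj' => hI _ (Finset.mem_filter.1 hj).2 _ hj' (h.adj j)⟩
  have h1 := (Finset.card_le_card hIJ).trans Finset.card_image_le
  have h2 := Finset.card_le_card hsub
  rw [Finset.card_image_of_injOn hinj, Finset.card_compl,
    Finset.card_insert_of_notMem hcI] at h2
  have := Finset.card_le_univ (insert c I)
  rw [Finset.card_insert_of_notMem hcI] at this
  omega

lemma card_filter_not_adj (G : SimpleGraph V) (u : V) :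
    #{v | u ≠ v ∧ ¬ G.Adj u v} + (G.degree u + 1) = Fintype.card V := by
  have : ({v | u ≠ v ∧ ¬ G.Adj u v} : Finset V) = (insert u (G.neighborFinset u))ᶜ := by
    ext v; simp [eq_comm]
  rw [this, Finset.card_compl, Finset.card_insert_of_notMem (by simp),
    card_neighborFinset_eq_degree]
  have := G.degree_lt_card_verts u
  omega

/-- If nonadjacent vertices have degree sum `n` and some degree is below `n / 2`, then two
vertices separate the graph. -/
lemma exists_separation_of_degree_lt (hV : 2 ≤ Fintype.card V)
    (hO : ∀ u v, u ≠ v → ¬ G.Adj u v → G.degree u + G.degree v = Fintype.card V) {u : V}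
    (hu : 2 * G.degree u < Fintype.card V) :
    ∃ c c' : V, c' ≠ c ∧ ∃ P : V → Prop,
      (∀ a b, a ≠ c → a ≠ c' → b ≠ c → b ≠ c' → G.Adj a b → (P a ↔ P b)) ∧
      (∃ a, a ≠ c ∧ a ≠ c' ∧ P a) ∧ ∃ b, b ≠ c ∧ b ≠ c' ∧ ¬ P b := by
  set n := Fintype.card V with hn
  set d := G.degree u with hd
  have hcount := card_filter_not_adj G u
  obtain ⟨v, hv⟩ : ({v | u ≠ v ∧ ¬ G.Adj u v} : Finset V).Nonempty := by
    rw [← Finset.card_pos]; omega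
  obtain ⟨huv, hav⟩ := (Finset.mem_filter.1 hv).2
  have hdv := hO u v huv hav
  have hdv' := G.degree_lt_card_verts v
  let A : Finset V := {x | G.degree x = d}
  let B : Finset V := {x | G.degree x = n - d}
  have memA : ∀ x, x ∈ A ↔ G.degree x = d := fun x => by simp [A]
  have memB : ∀ x, x ∈ B ↔ G.degree x = n - d := fun x => by simp [B]
  let r : V → V → Prop := fun x y => x ≠ y ∧ ¬ G.Adj x y
  have habove : ∀ x ∈ A, #(B.bipartiteAbove r x) = n - 1 - d := by
    intro x hx
    rw [memA] at hx
    have : B.bipartiteAbove r x = ({v | x ≠ v ∧ ¬ G.Adj x v} : Finset V) := by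
      ext w
      simp only [Finset.mem_bipartiteAbove, memB, Finset.mem_filter, Finset.mem_univ, true_and, r]
      refine and_iff_right_of_imp fun h => ?_
      have := hO x w h.1 h.2
      omega
    rw [this]
    have := card_filter_not_adj G x
    omega
  have hbelow : ∀ x ∈ B, #(A.bipartiteBelow r x) = d - 1 := by
    intro x hx
    rw [memB] at hx
    have : A.bipartiteBelow r x = ({v | x ≠ v ∧ ¬ G.Adj x v} : Finset V) := by
      ext w
      simp only [Finset.mem_bipartiteBelow, memA, Finset.mem_filter, Finset.mem_univ, true_and, r]
      rw [ne_comm, G.adj_comm]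
      refine and_iff_right_of_imp fun h => ?_
      have := hO x w h.1 h.2
      omega
    rw [this]
    have := card_filter_not_adj G x
    omega
  have hmul := Finset.card_mul_eq_card_mul r habove hbelow
  have hvB : v ∈ B := (memB v).2 (by omega)
  have huA : u ∈ A := (memA u).2 rfl
  have hdisj : Disjoint A B := by
    rw [Finset.disjoint_left]
    intro x hx hx'
    rw [memA] at hx
    rw [memB] at hx'
    omega
  have hAB : #A + #B ≤ n := by
    rw [← Finset.card_union_of_disjoint hdisj]; exact Finset.card_le_univ _
  have hAge : d - 1 ≤ #A := hbelow v hvB ▸ Finset.card_le_card (Finset.filter_subset _ _)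
  have hAcard : #A = d - 1 := by
    refine le_antisymm ?_ hAge
    by_contra! hlt
    obtain ⟨e, he⟩ : ∃ e, d = e + 1 := ⟨d - 1, by omega⟩
    obtain ⟨t, ht⟩ : ∃ t, n = 2 * e + 3 + t := ⟨n - (2 * e + 3), by omega⟩
    obtain ⟨a, ha⟩ : ∃ a, #A = e + 1 + a := ⟨#A - (e + 1), by omega⟩
    have hB : #B ≤ e + 2 + t := by omega
    rw [show n - 1 - d = e + 1 + t by omega, show d - 1 = e by omega, ha] at hmul
    nlinarith [Nat.mul_le_mul_right e hB, Nat.zero_le (a * (e + 1 + t))]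
  have hnone : ∀ a ∈ A, ∀ b ∈ B, ¬ G.Adj a b := by
    intro a ha b hb
    have heq : A.bipartiteBelow r b = A :=
      Finset.eq_of_subset_of_card_le (Finset.filter_subset _ _) (by rw [hbelow b hb, hAcard])
    rw [← heq, Finset.mem_bipartiteBelow] at ha
    exact ha.2.2
  have hBcard : #B = n - 1 - d := by
    rw [← habove u huA]
    congr 1
    ext b
    rw [Finset.mem_bipartiteAbove]
    exact (and_iff_left_of_imp fun hb =>
      ⟨by rintro rfl; exact Finset.disjoint_left.1 hdisj huA hb, hnone u huA b hb⟩).symm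
  have hC : #(A ∪ B)ᶜ = 2 := by
    rw [Finset.card_compl, Finset.card_union_of_disjoint hdisj]
    have : 0 < #A := Finset.card_pos.2 ⟨u, huA⟩
    omega
  obtain ⟨c, c', hcc, hcc'⟩ := Finset.card_eq_two.1 hC
  have hcover : ∀ x, x ≠ c → x ≠ c' → x ∉ A → x ∈ B := by
    intro x h1 h2 hA
    by_contra hB
    have : x ∈ (A ∪ B)ᶜ := by simp [hA, hB]
    rw [hcc'] at this
    simp [h1, h2] at this
  have hne : ∀ x ∈ A ∪ B, x ≠ c ∧ x ≠ c' := by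
    intro x hx
    have : x ∉ (A ∪ B)ᶜ := fun h => Finset.mem_compl.1 h hx
    rw [hcc'] at this
    simpa using this
  refine ⟨c, c', hcc.symm, (· ∈ A), ?_, ⟨u, ?_, ?_, huA⟩, ⟨v, ?_, ?_, ?_⟩⟩
  · intro a b h1 h2 h3 h4 hab
    constructor
    · exact fun ha => by_contra fun hb => hnone a ha b (hcover b h3 h4 hb) hab
    · exact fun hb => by_contra fun ha => hnone b hb a (hcover a h1 h2 ha) hab.symm
  · exact (hne u (Finset.mem_union_left _ huA)).1
  · exact (hne u (Finset.mem_union_left _ huA)).2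
  · exact (hne v (Finset.mem_union_right _ hvB)).1
  · exact (hne v (Finset.mem_union_right _ hvB)).2
  · exact Finset.disjoint_right.1 hdisj hvB

end Obstructions

section Sufficiency

variable {V : Type*} [Fintype V] {G : SimpleGraph V} {k : ℕ}

lemma exists_cycle_avoiding_top (hV : Fintype.card V = k + 1) (hk : 2 ≤ k) (v : V) :
    ∃ y, IsVertexCycle (⊤ : SimpleGraph V) k y ∧ ∀ i, y i ≠ v := by
  obtain ⟨p, rfl⟩ : ∃ p, k = p + 1 := ⟨k - 1, by omega⟩
  have hcard : Fintype.card {x // x ≠ v} = p + 1 := by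
    rw [Fintype.card_subtype_compl, Fintype.card_subtype_eq]; omega
  let e := (Fintype.equivFinOfCardEq hcard).symm
  have hinj : ∀ i ≤ p, ∀ j ≤ p, (e (Fin.ofNat (p + 1) i) : V) = e (Fin.ofNat (p + 1) j) →
      i = j := by
    intro i hi j hj hij
    have := congrArg Fin.val (e.injective (Subtype.ext hij))
    simpa [Fin.ofNat, Nat.mod_eq_of_lt (Nat.lt_succ_of_le hi),
      Nat.mod_eq_of_lt (Nat.lt_succ_of_le hj)] using this
  have hpath : IsVertexPath (⊤ : SimpleGraph V) p fun i => (e (Fin.ofNat (p + 1) i) : V) :=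
    { adj := fun i hi h => by have := hinj _ (by omega) _ (by omega) h; omega
      inj := hinj }
  exact ⟨_, hpath.toCycle fun h => by have := hinj _ (by omega) _ (by omega) h; omega,
    fun i => (e _).2⟩

lemma nonempty_iso_completeBipartiteGraph (hV : Fintype.card V = 2 * k) {I : Finset V}
    (hI : #I = k) (hG : ∀ a b, G.Adj a b ↔ (a ∈ I ↔ b ∉ I)) :
    Nonempty (G ≃g completeBipartiteGraph (Fin k) (Fin k)) := by
  have hIc : #Iᶜ = k := by rw [Finset.card_compl]; omega
  let e := I.equivFinOfCardEq hI
  let e' := Iᶜ.equivFinOfCardEq hIc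
  let f : Fin k ⊕ Fin k → V := Sum.elim (fun i => e.symm i) (fun i => e'.symm i)
  have hf1 : ∀ i, f (Sum.inl i) ∈ I := fun i => (e.symm i).2
  have hf2 : ∀ i, f (Sum.inr i) ∉ I := fun i => Finset.mem_compl.1 (e'.symm i).2
  have hinj : Function.Injective f := by
    rintro (i | i) (j | j) hij
    · exact congrArg _ (e.symm.injective (Subtype.ext hij))
    · exact absurd (hij ▸ hf1 i) (hf2 j)
    · exact absurd (hij ▸ hf1 j) (hf2 i)
    · exact congrArg _ (e'.symm.injective (Subtype.ext hij))
  have hbij : Function.Bijective f :=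
    (Fintype.bijective_iff_injective_and_card f).2 ⟨hinj, by simp [hV, two_mul]⟩
  refine ⟨RelIso.symm ⟨Equiv.ofBijective f hbij, ?_⟩⟩
  rintro (i | i) (j | j) <;> simp [hG, hf1, hf2]

/-- In a path avoiding just one vertex, whose middle vertex separates its two halves, the first
half and the middle vertex form a clique seen by the avoided vertex. -/
lemma IsVertexPath.adj_of_cut {x : ℕ → V} (h : IsVertexPath G (2 * k) x)
    (hV : Fintype.card V = 2 * k + 2) {v : V} (hv : ∀ i ≤ 2 * k, x i ≠ v)
    (hd : ∀ u, k + 1 ≤ G.degree u)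
    (hcut : ∀ a < k, ∀ b, k < b → b ≤ 2 * k → ¬ G.Adj (x a) (x b)) {a : ℕ} (ha : a < k) :
    G.Adj (x a) v ∧ ∀ j ≤ k, j ≠ a → G.Adj (x a) (x j) := by
  have hsub : G.neighborFinset (x a) ⊆ insert v (((range (k + 1)).erase a).image x) := by
    intro w hw
    rw [mem_neighborFinset] at hw
    rw [Finset.mem_insert, or_iff_not_imp_left]
    intro hwv
    obtain ⟨i, hi, rfl⟩ := h.exists_eq_of_ne hV hv hwv
    refine Finset.mem_image_of_mem _ ?_
    rw [Finset.mem_erase, Finset.mem_range]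
    refine ⟨by rintro rfl; exact G.loopless.irrefl _ hw, ?_⟩
    by_contra! hik
    exact hcut a ha i (by omega) hi hw
  have hcard : #(insert v (((range (k + 1)).erase a).image x)) ≤ G.degree (x a) := by
    refine (Finset.card_insert_le _ _).trans (le_trans (Nat.succ_le_succ ?_) (hd _))
    refine Finset.card_image_le.trans ?_
    rw [Finset.card_erase_of_mem (Finset.mem_range.2 (by omega)), Finset.card_range]
    omega
  rw [← card_neighborFinset_eq_degree] at hcard
  have heq := Finset.eq_of_subset_of_card_le hsub hcard
  constructor
  · rw [← mem_neighborFinset, heq]; exact Finset.mem_insert_self _ _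
  · intro j hj hja
    rw [← mem_neighborFinset, heq]
    exact Finset.mem_insert_of_mem (Finset.mem_image_of_mem _ (by
      rw [Finset.mem_erase, Finset.mem_range]; omega))

lemma IsVertexPath.nonempty_iso_graphJoin (hk : 2 ≤ k) {x : ℕ → V}
    (h : IsVertexPath G (2 * k) x)
    (hV : Fintype.card V = 2 * k + 2) {v : V} (hv : ∀ i ≤ 2 * k, x i ≠ v)
    (hd : ∀ u, k + 1 ≤ G.degree u)
    (hd' : ∀ u, (∀ w, w ≠ u → G.Adj u w) ∨ G.degree u = k + 1)
    (hcut : ∀ a < k, ∀ b, k < b → b ≤ 2 * k → ¬ G.Adj (x a) (x b)) :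
    Nonempty (G ≃g graphJoin (⊤ : SimpleGraph (Fin 2))
      ((⊤ : SimpleGraph (Fin k)) ⊕g (⊤ : SimpleGraph (Fin k)))) := by
  have hlow := fun a ha => h.adj_of_cut (a := a) hV hv hd hcut ha
  have hhigh := fun a ha => h.reverse.adj_of_cut (a := a) hV (fun i _ => hv _ (by omega)) hd
    (fun a ha b hb hbk hab => hcut (2 * k - b) (by omega) (2 * k - a) (by omega) (by omega)
      hab.symm) ha
  have hv1 : ∀ a ≤ 2 * k, a ≠ k → G.Adj (x a) v := by
    intro a ha hak
    rcases lt_or_gt_of_ne hak with hlt | hgt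
    · exact (hlow a hlt).1
    · have := (hhigh (2 * k - a) (by omega)).1
      rwa [show 2 * k - (2 * k - a) = a by omega] at this
  have hh2 : ∀ a, k < a → a ≤ 2 * k → ∀ b, k ≤ b → b ≤ 2 * k → b ≠ a → G.Adj (x a) (x b) := by
    intro a ha ha' b hb hb' hba
    have := (hhigh (2 * k - a) (by omega)).2 (2 * k - b) (by omega) (by omega)
    rwa [show 2 * k - (2 * k - a) = a by omega, show 2 * k - (2 * k - b) = b by omega] at this
  have hvk : G.Adj v (x k) := by
    rcases hd' v with hall | hdeg
    · exact hall _ (hv k (by omega))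
    · exfalso
      have hsub : ((range (2 * k + 1)).erase k).image x ⊆ G.neighborFinset v := by
        intro w hw
        obtain ⟨a, ha, rfl⟩ := Finset.mem_image.1 hw
        rw [Finset.mem_erase, Finset.mem_range] at ha
        rw [mem_neighborFinset]
        exact (hv1 a (by omega) ha.1).symm
      have := Finset.card_le_card hsub
      rw [Finset.card_image_of_injOn, Finset.card_erase_of_mem (Finset.mem_range.2 (by omega)),
        Finset.card_range, card_neighborFinset_eq_degree] at this
      · omega
      · intro a ha b hb hab
        simp only [Finset.coe_erase, Finset.coe_range, Set.mem_sdiff, Set.mem_Iio] at ha hb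
        exact h.inj a (by omega) b (by omega) hab
  let f : Fin 2 ⊕ (Fin k ⊕ Fin k) → V :=
    Sum.elim (fun i => if i = 0 then v else x k)
      (Sum.elim (fun i => x i) (fun i => x (k + 1 + i)))
  have f0 : f (Sum.inl 0) = v := rfl
  have f1 : f (Sum.inl 1) = x k := rfl
  have f2 : ∀ i, f (Sum.inr (Sum.inl i)) = x i := fun i => rfl
  have f3 : ∀ i, f (Sum.inr (Sum.inr i)) = x (k + 1 + i) := fun i => rfl
  have hsurj : Function.Surjective f := by
    intro w
    by_cases hw : w = v
    · exact ⟨Sum.inl 0, hw ▸ f0⟩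
    obtain ⟨i, hi, rfl⟩ := h.exists_eq_of_ne hV hv hw
    rcases lt_trichotomy i k with hik | rfl | hik
    · exact ⟨Sum.inr (Sum.inl ⟨i, hik⟩), rfl⟩
    · exact ⟨Sum.inl 1, f1⟩
    · refine ⟨Sum.inr (Sum.inr ⟨i - (k + 1), by omega⟩), ?_⟩
      rw [f3]; congr 1; simp only; omega
  have hbij : Function.Bijective f :=
    (Fintype.bijective_iff_surjective_and_card f).2
      ⟨hsurj, by simp only [Fintype.card_sum, Fintype.card_fin]; omega⟩
  have hadj : ∀ a b, a ≠ b → (G.Adj (f a) (f b) ↔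
      (graphJoin (⊤ : SimpleGraph (Fin 2))
        ((⊤ : SimpleGraph (Fin k)) ⊕g (⊤ : SimpleGraph (Fin k)))).Adj a b) := by
    have hout : ∀ i : Fin 2, ∀ a ≤ 2 * k, a ≠ k → G.Adj (f (Sum.inl i)) (x a) := by
      intro i a ha hak
      fin_cases i
      · exact (hv1 a ha hak).symm
      · rcases lt_or_gt_of_ne hak with hlt | hgt
        · exact ((hlow a hlt).2 k le_rfl (by omega)).symm
        · exact (hh2 a hgt ha k le_rfl (by omega) (by omega)).symm
    rintro (i | i | i) (j | j | j) hij
    · refine iff_of_true ?_ (by simpa [graphJoin] using hij)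
      fin_cases i <;> fin_cases j
      · exact absurd rfl hij
      · exact hvk
      · exact hvk.symm
      · exact absurd rfl hij
    · exact iff_of_true (hout i j (by omega) (by omega)) (by simp [graphJoin])
    · exact iff_of_true (hout i (k + 1 + j) (by omega) (by omega)) (by simp [graphJoin])
    · exact iff_of_true (hout j i (by omega) (by omega)).symm (by simp [graphJoin])
    · have hne : i ≠ j := fun h => hij (by rw [h])
      exact iff_of_true ((hlow i i.2).2 j (by omega) fun h => hne (Fin.ext h.symm))
        (by simpa [graphJoin] using hne)
    · exact iff_of_false (hcut i i.2 (k + 1 + j) (by omega) (by omega)) (by simp [graphJoin])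
    · exact iff_of_true (hout j (k + 1 + i) (by omega) (by omega)).symm (by simp [graphJoin])
    · exact iff_of_false (fun h => hcut j j.2 (k + 1 + i) (by omega) (by omega) h.symm)
        (by simp [graphJoin])
    · have hne : i ≠ j := fun h => hij (by rw [h])
      exact iff_of_true (hh2 (k + 1 + i) (by omega) (by omega) (k + 1 + j) (by omega) (by omega)
        fun h => hne (Fin.ext (by omega))) (by simpa [graphJoin] using hne)
  refine ⟨RelIso.symm ⟨Equiv.ofBijective f hbij, fun {a b} => ?_⟩⟩
  rcases eq_or_ne a b with rfl | hab
  · simp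
  · exact hadj a b hab

end Sufficiency

section Characterization

variable {V : Type*} [Fintype V] {G : SimpleGraph V} {k : ℕ}

lemma nonempty_iso_completeBipartiteGraph_of_independent
    (hV : Fintype.card V = 2 * k + 2) (hk : 1 ≤ k) {S : Finset V}
    (hS : ∀ x ∈ S, ∀ y, y ≠ x → G.Adj x y) (hZ : ∀ z ∉ S, G.degree z = k + 1)
    (hSk : #S < k + 1) {I : Finset V} (hIk : k + 1 ≤ #I)
    (hI : ∀ a ∈ I, ∀ b ∈ I, ¬ G.Adj a b) :
    Nonempty (G ≃g completeBipartiteGraph (Fin (k + 1)) (Fin (k + 1))) := by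
  have hIS : ∀ a ∈ I, a ∉ S := by
    intro a ha haS
    obtain ⟨b, hb, hba⟩ := Finset.exists_mem_ne (show 1 < #I by omega) a
    exact hI a ha b hb (hS a haS b hba)
  have hnb : ∀ a ∈ I, G.neighborFinset a = Iᶜ := by
    intro a ha
    refine Finset.eq_of_subset_of_card_le (fun w hw => ?_) ?_
    · rw [mem_neighborFinset] at hw
      exact Finset.mem_compl.2 fun h => hI a ha w h hw
    · rw [card_neighborFinset_eq_degree, hZ a (hIS a ha), Finset.card_compl]; omega
  obtain ⟨a₀, ha₀⟩ : I.Nonempty := Finset.card_pos.1 (by omega)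
  have hIc : #Iᶜ = k + 1 := by
    rw [← hnb a₀ ha₀, card_neighborFinset_eq_degree, hZ a₀ (hIS a₀ ha₀)]
  have hIcard : #I = k + 1 := by
    rw [Finset.card_compl] at hIc; omega
  have hadj : ∀ a ∈ I, ∀ b ∉ I, G.Adj a b := by
    intro a ha b hb
    rw [← mem_neighborFinset, hnb a ha, Finset.mem_compl]
    exact hb
  have hnbc : ∀ b ∉ I, b ∉ S → G.neighborFinset b = I := by
    intro b hb hbS
    refine (Finset.eq_of_subset_of_card_le (fun w hw => ?_) ?_).symm
    · rw [mem_neighborFinset]; exact (hadj w hw b hb).symm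
    · rw [card_neighborFinset_eq_degree, hZ b hbS, hIcard]
  have hSe : ∀ b, b ∉ S := by
    intro b hbS
    have hbI : b ∉ I := fun h => hIS b h hbS
    have hsub : Iᶜ ⊆ S := by
      intro c hc
      rw [Finset.mem_compl] at hc
      by_contra hcS
      have hcb : c ≠ b := by rintro rfl; exact hcS hbS
      have := hnbc c hc hcS ▸ (G.mem_neighborFinset c b).2 (hS b hbS c hcb).symm
      exact hbI this
    have := Finset.card_le_card hsub
    omega
  refine nonempty_iso_completeBipartiteGraph (by omega) hIcard fun a b => ?_
  by_cases ha : a ∈ I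
  · rw [← mem_neighborFinset, hnb a ha]; simp [ha]
  · rw [← mem_neighborFinset, hnbc a ha (hSe a)]; simp [ha]

lemma exists_cycle_avoiding (hV : Fintype.card V = 2 * k + 2) (hk : 2 ≤ k) {S : Finset V}
    (hS : ∀ x ∈ S, ∀ y, y ≠ x → G.Adj x y) (hZ : ∀ z ∉ S, G.degree z = k + 1)
    (hSk : #S < k + 1)
    (hsep : ¬ Nonempty (G ≃g graphJoin (⊤ : SimpleGraph (Fin 2))
      ((⊤ : SimpleGraph (Fin k)) ⊕g (⊤ : SimpleGraph (Fin k)))))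
    (hbip : ¬ Nonempty (G ≃g completeBipartiteGraph (Fin (k + 1)) (Fin (k + 1)))) (v : V) :
    ∃ y, IsVertexCycle G (2 * k + 1) y ∧ ∀ i, y i ≠ v := by
  have hd' : ∀ u, (∀ w, w ≠ u → G.Adj u w) ∨ G.degree u = k + 1 := fun u =>
    (em (u ∈ S)).imp (hS u) (hZ u)
  have hd : ∀ u, k + 1 ≤ G.degree u := by
    intro u
    rcases hd' u with h | h
    · have h1 := card_filter_not_adj G u
      have h2 : ({v | u ≠ v ∧ ¬ G.Adj u v} : Finset V) = ∅ :=
        Finset.filter_eq_empty_iff.2 fun w _ hw => hw.2 (h w hw.1.symm)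
      rw [h2, Finset.card_empty] at h1
      omega
    · exact h.ge
  let W := {x // x ≠ v}
  let H : SimpleGraph W := G.comap Subtype.val
  have hW : Fintype.card W = 2 * k + 1 := by
    rw [Fintype.card_subtype_compl, Fintype.card_subtype_eq]; omega
  have hHd : ∀ w, k ≤ H.degree w := by
    intro w
    have hsub : G.neighborFinset w ⊆ insert v ((H.neighborFinset w).image Subtype.val) := by
      intro u hu
      rw [mem_neighborFinset] at hu
      rw [Finset.mem_insert, or_iff_not_imp_left]
      exact fun huv => Finset.mem_image.2 ⟨⟨u, huv⟩, (H.mem_neighborFinset _ _).2 hu, rfl⟩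
    have h1 := (Finset.card_le_card hsub).trans (Finset.card_insert_le _ _)
    have h2 := Finset.card_image_le (s := H.neighborFinset w) (f := Subtype.val)
    rw [card_neighborFinset_eq_degree] at h1 h2
    have := hd w
    omega
  rcases hamiltonian_or_independent_or_cut (by omega) hW hHd with
    ⟨y, hy⟩ | ⟨I, hIk, hI⟩ | ⟨x, hx, hcut⟩
  · exact ⟨fun i => y i, ⟨hy.adj, fun i j => Subtype.val_inj.trans (hy.eq_iff i j)⟩,
      fun i => (y i).2⟩
  · refine absurd (nonempty_iso_completeBipartiteGraph_of_independent hV (by omega) hS hZ hSk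
      (I := I.map (Function.Embedding.subtype _)) (by simpa using hIk) ?_) hbip
    intro a ha b hb
    obtain ⟨a', ha', rfl⟩ := Finset.mem_map.1 ha
    obtain ⟨b', hb', rfl⟩ := Finset.mem_map.1 hb
    exact hI a' ha' b' hb'
  · have hx' : IsVertexPath G (2 * k) fun i => (x i : V) :=
      ⟨hx.adj, fun i hi j hj hij => hx.inj i hi j hj (Subtype.ext hij)⟩
    exact absurd (hx'.nonempty_iso_graphJoin hk hV (fun i _ => (x i).2) hd hd' hcut) hsep

lemma not_nonempty_iso_graphJoin {m : ℕ} (hm : m ≠ 0) (hV : Fintype.card V = m + 1) (hk : k ≠ 0)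
    (hc : ∀ v, ∃ y, IsVertexCycle G m y ∧ ∀ i, y i ≠ v) :
    ¬ Nonempty (G ≃g graphJoin (⊤ : SimpleGraph (Fin 2))
      ((⊤ : SimpleGraph (Fin k)) ⊕g (⊤ : SimpleGraph (Fin k)))) := by
  rintro ⟨φ⟩
  have hk0 : 0 < k := Nat.pos_of_ne_zero hk
  obtain ⟨y, hy, hyc⟩ := hc (φ.symm (Sum.inl 0))
  have hiff := hy.not_separated (c' := φ.symm (Sum.inl 1)) hm hV hyc (by simp)
    (fun x => ∃ i, φ x = Sum.inr (Sum.inl i)) ?_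
    (a := φ.symm (Sum.inr (Sum.inl ⟨0, hk0⟩))) (b := φ.symm (Sum.inr (Sum.inr ⟨0, hk0⟩)))
    (by simp) (by simp) (by simp) (by simp)
  · simp at hiff
  · intro a b ha ha' hb hb' hab
    rw [← φ.map_adj_iff] at hab
    have hne : ∀ x, x ≠ φ.symm (Sum.inl 0) → x ≠ φ.symm (Sum.inl 1) → ∀ i, φ x ≠ Sum.inl i := by
      intro x h0 h1 i hi
      obtain rfl : x = φ.symm (Sum.inl i) := by rw [← hi]; simp
      fin_cases i
      · exact h0 rfl
      · exact h1 rfl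
    have hna := hne a ha ha'
    have hnb := hne b hb hb'
    generalize φ a = a' at *
    generalize φ b = b' at *
    rcases a' with i | i | i <;> rcases b' with j | j | j <;>
      simp_all [graphJoin]

lemma not_nonempty_iso_completeBipartiteGraph {m : ℕ} (hm : m ≠ 0)
    (hV : Fintype.card V = m + 1) (hVk : Fintype.card V = 2 * k) (hk : k ≠ 0)
    (hc : ∀ v, ∃ y, IsVertexCycle G m y ∧ ∀ i, y i ≠ v) :
    ¬ Nonempty (G ≃g completeBipartiteGraph (Fin k) (Fin k)) := by
  rintro ⟨φ⟩
  obtain ⟨y, hy, hyc⟩ := hc (φ.symm (Sum.inr ⟨0, Nat.pos_of_ne_zero hk⟩))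
  let I : Finset V := Finset.univ.image fun i => φ.symm (Sum.inl i)
  have hI : #I = k :=
    (Finset.card_image_of_injective _ (φ.symm.injective.comp Sum.inl_injective)).trans (by simp)
  have := hy.card_independent_lt hm hV hyc (I := I) (by simp [I]) (by
    intro a ha b hb
    obtain ⟨i, -, rfl⟩ := Finset.mem_image.1 ha
    obtain ⟨j, -, rfl⟩ := Finset.mem_image.1 hb
    rw [φ.symm.map_adj_iff]
    simp)
  omega

/-- In a weakly closed graph satisfying Ore's condition, all of whose vertex-deleted subgraphs
are Hamiltonian, the vertices that are not universal have degree `n / 2` and they are more than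
half of all vertices. -/
lemma exists_isZJoinK [DecidableEq V] {m : ℕ} (hm : m ≠ 0) (hV : Fintype.card V = m + 1)
    (hO : ∀ u v, u ≠ v → ¬ G.Adj u v → G.degree u + G.degree v = Fintype.card V)
    (hG : G ≠ ⊤) (hc : ∀ v, ∃ y, IsVertexCycle G m y ∧ ∀ i, y i ≠ v) :
    Even (Fintype.card V) ∧ ∃ s, 2 * s < Fintype.card V ∧ IsZJoinK G s := by
  have hdeg : ∀ u, Fintype.card V ≤ 2 * G.degree u := by
    intro u
    by_contra! hu
    obtain ⟨c, c', hcc, P, hP, ⟨a, ha, ha', hPa⟩, b, hb, hb', hPb⟩ :=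
      exists_separation_of_degree_lt (by omega) hO hu
    obtain ⟨y, hy, hyc⟩ := hc c
    exact hPb ((hy.not_separated hm hV hyc hcc P hP ha ha' hb hb').1 hPa)
  have hnon : ∀ u v, u ≠ v → ¬ G.Adj u v → 2 * G.degree u = Fintype.card V := by
    intro u v huv hav
    have := hO u v huv hav
    have := hdeg u
    have := hdeg v
    omega
  obtain ⟨z, z', hzz, hz⟩ : ∃ u v, u ≠ v ∧ ¬ G.Adj u v := by
    by_contra! h
    exact hG (by ext u v; exact ⟨fun h => h.ne, h u v⟩)
  have hdz := hnon z z' hzz hz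
  let S : Finset V := {x | ∀ y, y ≠ x → G.Adj x y}
  have memS : ∀ x, x ∈ S ↔ ∀ y, y ≠ x → G.Adj x y := fun x => by simp [S]
  have hZ : ∀ u ∉ S, 2 * G.degree u = Fintype.card V := by
    intro u hu
    rw [memS] at hu
    push Not at hu
    obtain ⟨w, hw, hw'⟩ := hu
    exact hnon u w hw.symm hw'
  have hSsub : ∀ u ∉ S, S ⊆ G.neighborFinset u := by
    intro u hu s hs
    rw [mem_neighborFinset]
    exact ((memS s).1 hs u (by rintro rfl; exact hu hs)).symm
  have hzS : z ∉ S := fun h => hz ((memS z).1 h z' hzz.symm)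
  have hle := Finset.card_le_card (hSsub z hzS)
  rw [card_neighborFinset_eq_degree] at hle
  refine ⟨⟨G.degree z, by omega⟩, #S, ?_, S, rfl, fun x hx => (memS x).1 hx, hZ⟩
  by_contra! hlt
  obtain ⟨s, hs⟩ : S.Nonempty := Finset.card_pos.1 (by omega)
  obtain ⟨y, hy, hyc⟩ := hc s
  have := hy.card_independent_lt hm hV hyc (I := Sᶜ) (by simpa using hs) (by
    intro a ha b hb hab
    rw [Finset.mem_compl] at ha hb
    have heq : S = G.neighborFinset a := by
      refine Finset.eq_of_subset_of_card_le (hSsub a ha) ?_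
      rw [card_neighborFinset_eq_degree]
      have := hZ a ha
      omega
    exact hb (heq ▸ (G.mem_neighborFinset a b).2 hab))
  rw [Finset.card_compl] at this
  omega

end Characterization

lemma IsWeakClosure.le {V : Type*} [Fintype V] {G H : SimpleGraph V} (h : IsWeakClosure G H) :
    G ≤ H := by
  refine Relation.ReflTransGen.rec (motive := fun H _ => G ≤ H) le_rfl ?_ h.1
  rintro K L - ⟨u, v, -, -, -, rfl⟩ ih
  exact ih.trans le_sup_left

/-- In the weak closure of a graph satisfying Ore's condition, nonadjacent vertices have degree
sum exactly `n`. -/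
lemma IsWeakClosure.degree_add_degree_eq {V : Type*} [Fintype V] {G H : SimpleGraph V}
    (h : IsWeakClosure G H) (hG : IsOTG G) (u v : V) (huv : u ≠ v) (ha : ¬ H.Adj u v) :
    H.degree u + H.degree v = Fintype.card V := by
  have h1 := hG u v huv fun hadj => ha (h.le hadj)
  have h2 := h.2 u v huv ha
  have h3 := G.degree_le_of_le (v := u) h.le
  have h4 := G.degree_le_of_le (v := v) h.le
  omega

/-- For the weak closure `Gw` of an OTG with `n ≥ 5` vertices, `h(Gw) = n` iff `Gw ∈ φ₃`. -/
theorem stmt_13 {V : Type*} [Fintype V] [DecidableEq V] (Gw : SimpleGraph V)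
    (hn : 5 ≤ Fintype.card V)
    (hGw : ∃ G : SimpleGraph V, IsOTG G ∧ IsWeakClosure G Gw) :
    hForce Gw = Fintype.card V ↔ InPhiThree Gw := by
  obtain ⟨G, hG, hcl⟩ := hGw
  have hO := hcl.degree_add_degree_eq hG
  obtain ⟨m, hm⟩ : ∃ m, Fintype.card V = m + 1 := ⟨Fintype.card V - 1, by omega⟩
  rw [hForce_eq_card_iff Gw (by omega) hm]
  constructor
  · intro hc
    refine or_iff_not_imp_left.2 fun hne => ?_
    obtain ⟨he, hs⟩ := exists_isZJoinK (by omega) hm hO hne hc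
    obtain ⟨q, hq⟩ := he
    exact ⟨⟨q, hq⟩, hs, not_nonempty_iso_graphJoin (by omega) hm (by omega) hc,
      not_nonempty_iso_completeBipartiteGraph (by omega) hm (by omega) (by omega) hc⟩
  · rintro (rfl | ⟨⟨q, hq⟩, ⟨s, hs, S, rfl, hS, hZ⟩, hsep, hbip⟩)
    · exact exists_cycle_avoiding_top hm (by omega)
    · obtain ⟨k, rfl⟩ : ∃ k, q = k + 1 := ⟨q - 1, by omega⟩
      obtain rfl : m = 2 * k + 1 := by omega
      rw [show Fintype.card V / 2 - 1 = k by omega] at hsep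
      rw [show Fintype.card V / 2 = k + 1 by omega] at hbip
      refine exists_cycle_avoiding (by omega) (by omega) hS (fun z hz => ?_) (by omega) hsep hbip
      have := hZ z hz
      omega
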